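/- s(n) = c·n + O(n/(log n · log log n)) as n → ∞, where c = ∑_{p prime} (1/(p(p+1))) · ∏_{q prime, q < p} (1 - 1/q); in particular, lim_{n→∞} s(n)/n = c. -/

import Mathlib

def S (n : ℕ) : Finset ℕ := (Finset.Icc 1 (n / 2)).image (fun k => n % k)

def s (n : ℕ) : ℕ := (S n).card

noncomputable def c : ℝ :=
  ∑' p : Nat.Primes,
    (1 / (((p : ℕ) : ℝ) * ((p : ℕ) + 1))) *
      ∏ q ∈ (Finset.range (p : ℕ)).filter Nat.Prime, (1 - 1 / (q : ℝ))

/-- the primes below k -/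
def Qs (k : ℕ) : Finset ℕ := (Finset.range k).filter Nat.Prime

noncomputable def PP (k : ℕ) : ℝ := ∏ q ∈ Qs k, (1 - 1 / (q : ℝ))

def AA (Q : Finset ℕ) (N : ℕ) : ℕ := ((Finset.Icc 1 N).filter (fun l => ∀ q ∈ Q, ¬ q ∣ l)).card

def MM (n : ℕ) : Finset ℕ :=
  (Finset.Icc 2 n).filter (fun m => n * m.minFac < m * (m.minFac + 1))

lemma S_eq (n : ℕ) : S n = (MM n).image (fun m => n - m) := by
  ext r
  simp only [S, MM, Finset.mem_image, Finset.mem_Icc, Finset.mem_filter]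
  constructor
  · rintro ⟨k, ⟨hk1, hk2⟩, rfl⟩
    have hdm := Nat.div_add_mod n k
    have hlt := Nat.mod_lt n (show k > 0 by omega)
    have ht : 2 ≤ n / k := by
      rw [Nat.le_div_iff_mul_le (by omega)]; omega
    have hm : 2 ≤ k * (n / k) := by nlinarith
    refine ⟨k * (n / k), ⟨⟨hm, by omega⟩, ?_⟩, by omega⟩
    have hp : (k * (n / k)).minFac ≤ n / k := by
      apply (Nat.minFac_le_of_dvd ht (Dvd.intro_left k rfl))
    have hp0 : 0 < (k * (n / k)).minFac := Nat.minFac_pos _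
    generalize (k * (n / k)).minFac = p at *
    generalize n / k = t at *
    generalize n % k = r at *
    subst hdm
    nlinarith
  · rintro ⟨m, ⟨⟨hm2, hmn⟩, h⟩, rfl⟩
    have hpp : m.minFac.Prime := Nat.minFac_prime (by omega)
    obtain ⟨k, hk⟩ := Nat.minFac_dvd m
    have hp2 := hpp.two_le
    generalize m.minFac = p at *
    obtain ⟨d, rfl⟩ := Nat.exists_eq_add_of_le hmn
    have hd : d < k := by
      subst hk
      by_contra hc
      push Not at hc
      nlinarith
    refine ⟨k, ⟨by omega, ?_⟩, ?_⟩
    · rw [Nat.le_div_iff_mul_le (by omega)]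
      nlinarith
    · subst hk
      rw [mul_comm p k, Nat.mul_add_mod, Nat.mod_eq_of_lt hd]; omega

lemma s_eq (n : ℕ) : s n = (MM n).card := by
  rw [s, S_eq, Finset.card_image_of_injOn]
  intro a ha b hb hab
  simp only [MM, Finset.coe_filter, Finset.mem_Icc, Set.mem_ofPred_eq] at ha hb hab
  omega

lemma AA_insert (Q : Finset ℕ) (hQ : ∀ q ∈ Q, q.Prime) (q : ℕ) (hq : q.Prime) (hn : q ∉ Q) (N : ℕ) :
    AA (insert q Q) N + AA Q (N / q) = AA Q N := by
  have h2 : AA Q (N / q) = ((Finset.Icc 1 N).filter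
      (fun l => (∀ q ∈ Q, ¬ q ∣ l) ∧ q ∣ l)).card := by
    rw [AA, ← Finset.card_image_of_injective _ (mul_right_injective₀ hq.ne_zero)]
    congr 1
    ext l
    simp only [Finset.mem_image, Finset.mem_filter, Finset.mem_Icc]
    constructor
    · rintro ⟨a, ⟨⟨h1, h2⟩, h3⟩, rfl⟩
      rw [Nat.le_div_iff_mul_le hq.pos] at h2
      have := hq.pos
      refine ⟨⟨by nlinarith, by linarith [mul_comm a q]⟩, ?_, Dvd.intro _ rfl⟩
      intro r hr hd
      rcases (hQ r hr).dvd_mul.1 hd with h | h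
      · rw [Nat.prime_dvd_prime_iff_eq (hQ r hr) hq] at h
        exact hn (h ▸ hr)
      · exact h3 r hr h
    · rintro ⟨⟨h1, h2⟩, h3, ⟨a, rfl⟩⟩
      refine ⟨a, ⟨⟨?_, ?_⟩, ?_⟩, rfl⟩
      · rcases Nat.eq_zero_or_pos a with h | h
        · simp [h] at h1
        · exact h
      · rw [Nat.le_div_iff_mul_le hq.pos]; linarith [mul_comm a q]
      · intro r hr hd
        exact h3 r hr (hd.mul_left q)
  have h1 : AA (insert q Q) N = ((Finset.Icc 1 N).filter
      (fun l => (∀ q ∈ Q, ¬ q ∣ l) ∧ ¬ q ∣ l)).card := by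
    rw [AA]; congr 1; ext l; simp only [Finset.mem_filter, Finset.forall_mem_insert]; tauto
  rw [h1, h2, AA, ← Finset.filter_filter, ← Finset.filter_filter, add_comm]
  exact Finset.card_filter_add_card_filter_not _

lemma AA_bound (Q : Finset ℕ) : (∀ q ∈ Q, q.Prime) → ∀ x : ℝ, 0 ≤ x →
    |(AA Q ⌊x⌋₊ : ℝ) - x * ∏ q ∈ Q, (1 - 1 / (q : ℝ))| ≤ 2 ^ Q.card := by
  induction Q using Finset.induction_on with
  | empty =>
    intro _ x hx
    have h1 := Nat.floor_le hx
    have h2 := Nat.lt_floor_add_one x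
    simp only [AA, Finset.notMem_empty, false_implies, implies_true, Finset.filter_true, Nat.card_Icc,
      Finset.prod_empty, Finset.card_empty, Nat.add_sub_cancel]
    rw [abs_le]; constructor <;> linarith
  | insert q Q hn ih =>
    intro hQ x hx
    have hQ' : ∀ q ∈ Q, q.Prime := fun r hr => hQ r (Finset.mem_insert_of_mem hr)
    have hq := hQ q (Finset.mem_insert_self _ _)
    have e := AA_insert Q hQ' q hq hn ⌊x⌋₊
    rw [← Nat.floor_div_natCast] at e
    have e' : (AA (insert q Q) ⌊x⌋₊ : ℝ) = AA Q ⌊x⌋₊ - AA Q ⌊x / q⌋₊ := by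
      rw [← e]; push_cast; ring
    have a := ih hQ' x hx
    have b := ih hQ' (x / q) (by positivity)
    rw [e', Finset.prod_insert hn, Finset.card_insert_of_notMem hn, pow_succ]
    have : x * ((1 - 1 / (q : ℝ)) * ∏ q ∈ Q, (1 - 1 / (q : ℝ))) =
      x * ∏ q ∈ Q, (1 - 1 / (q : ℝ)) - x / q * ∏ q ∈ Q, (1 - 1 / (q : ℝ)) := by ring
    rw [this]
    rw [abs_le] at *
    constructor <;> linarith

lemma Qs_prime (k : ℕ) : ∀ q ∈ Qs k, q.Prime := fun q hq => (Finset.mem_filter.1 hq).2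

lemma Qs_card (k : ℕ) : (Qs k).card ≤ k := by
  have := Finset.card_filter_le (Finset.range k) Nat.Prime
  rw [Finset.card_range] at this
  exact this

lemma AA_bound' (k n d : ℕ) :
    |(AA (Qs k) (n / d) : ℝ) - n / d * PP k| ≤ 2 ^ k := by
  have := AA_bound (Qs k) (Qs_prime k) ((n : ℝ) / d) (by positivity)
  rw [Nat.floor_div_eq_div] at this
  exact this.trans (pow_le_pow_right₀ (by norm_num) (Qs_card k))

lemma fiber_card (n p : ℕ) (hp : p.Prime) :
    ((MM n).filter (fun m => m.minFac = p)).card + AA (Qs p) (n / (p + 1)) = AA (Qs p) (n / p) := by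
  have hle : n / (p + 1) ≤ n / p := Nat.div_le_div_left (by omega) hp.pos
  have h1 : ((MM n).filter (fun m => m.minFac = p)).card =
      ((Finset.Icc 1 (n / p)).filter
        (fun l => (∀ q ∈ Qs p, ¬ q ∣ l) ∧ ¬ l ≤ n / (p + 1))).card := by
    symm
    rw [← Finset.card_image_of_injective _ (mul_right_injective₀ hp.ne_zero)]
    congr 1
    ext m
    simp only [Finset.mem_image, Finset.mem_filter, Finset.mem_Icc, MM,
      Nat.le_div_iff_mul_le hp.pos, Nat.le_div_iff_mul_le (Nat.succ_pos p)]
    simp only [Qs, Finset.mem_filter, Finset.mem_range]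
    have hp2 := hp.two_le
    constructor
    · rintro ⟨l, ⟨⟨h1, h2⟩, h3, h4⟩, rfl⟩
      have hmf : (p * l).minFac = p := by
        apply le_antisymm (Nat.minFac_le_of_dvd hp2 (Dvd.intro _ rfl))
        by_contra hc
        push Not at hc
        have hne : p * l ≠ 1 := by
          intro h
          have := Nat.eq_one_of_mul_eq_one_right h
          omega
        have hpr := Nat.minFac_prime hne
        rcases hpr.dvd_mul.1 (Nat.minFac_dvd (p * l)) with h | h
        · rw [Nat.prime_dvd_prime_iff_eq hpr hp] at h
          omega
        · exact h3 _ ⟨hc, hpr⟩ h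
      rw [hmf]
      refine ⟨⟨⟨by nlinarith, by linarith [mul_comm p l]⟩, ?_⟩, rfl⟩
      push Not at h4
      nlinarith
    · rintro ⟨⟨⟨h1, h2⟩, h3⟩, rfl⟩
      obtain ⟨l, hl⟩ := Nat.minFac_dvd m
      have key : ∀ q, q.Prime → q ∣ m → m.minFac ≤ q := fun q hq hd => Nat.minFac_le_of_dvd hq.two_le hd
      generalize m.minFac = p at *
      subst hl
      refine ⟨l, ⟨⟨?_, by linarith [mul_comm p l]⟩, ?_, ?_⟩, rfl⟩
      · rcases Nat.eq_zero_or_pos l with h | h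
        · simp [h] at h1
        · exact h
      · rintro q ⟨hq1, hq2⟩ hd
        have := key q hq2 (hd.mul_left p)
        omega
      · intro hc
        nlinarith
  have h2 : AA (Qs p) (n / (p + 1)) = ((Finset.Icc 1 (n / p)).filter
        (fun l => (∀ q ∈ Qs p, ¬ q ∣ l) ∧ l ≤ n / (p + 1))).card := by
    rw [AA]; congr 1; ext l
    simp only [Finset.mem_filter, Finset.mem_Icc]
    constructor
    · rintro ⟨⟨a, b⟩, d⟩; exact ⟨⟨a, b.trans hle⟩, d, b⟩
    · rintro ⟨⟨a, b⟩, d, e⟩; exact ⟨⟨a, e⟩, d⟩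
  rw [h1, h2, AA, ← Finset.filter_filter, ← Finset.filter_filter, add_comm]
  exact Finset.card_filter_add_card_filter_not _

lemma tail_card (n Y : ℕ) :
    ((MM n).filter (fun m => Y < m.minFac)).card ≤ AA (Qs (Y + 1)) (n / (Y + 1)) := by
  rw [AA]
  apply Finset.card_le_card_of_injOn (fun m => m / m.minFac)
  · intro m hm
    simp only [MM, Finset.coe_filter, Finset.mem_filter, Finset.mem_Icc, Set.mem_ofPred_eq] at hm
    rw [Finset.mem_coe, Finset.mem_filter, Finset.mem_Icc]
    simp only [Qs, Finset.mem_filter, Finset.mem_range]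
    obtain ⟨⟨⟨h1, h2⟩, h3⟩, h4⟩ := hm
    obtain ⟨l, hl⟩ := Nat.minFac_dvd m
    have hpos := Nat.minFac_pos m
    have key : ∀ q, q.Prime → q ∣ m → m.minFac ≤ q := fun q hq hd => Nat.minFac_le_of_dvd hq.two_le hd
    generalize m.minFac = p at *
    subst hl
    rw [Nat.mul_div_cancel_left _ hpos, Nat.le_div_iff_mul_le (Nat.succ_pos Y)]
    refine ⟨⟨?_, ?_⟩, ?_⟩
    · rcases Nat.eq_zero_or_pos l with h | h
      · simp [h] at h1
      · exact h
    · nlinarith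
    · rintro q ⟨hq1, hq2⟩ hd
      have := key q hq2 (hd.mul_left p)
      omega
  · have main : ∀ m ∈ (MM n).filter (fun m => Y < m.minFac),
        m = (n / (m / m.minFac)) * (m / m.minFac) := by
      intro m hm
      simp only [MM, Finset.mem_filter, Finset.mem_Icc] at hm
      obtain ⟨⟨⟨h1, h2⟩, h3⟩, h4⟩ := hm
      obtain ⟨l, hl⟩ := Nat.minFac_dvd m
      have hpos := Nat.minFac_pos m
      generalize m.minFac = p at *
      subst hl
      rw [Nat.mul_div_cancel_left _ hpos]
      have : n / l = p := by
        apply Nat.div_eq_of_lt_le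
        · exact h2
        · by_contra hc
          push Not at hc
          nlinarith
      rw [this]
    intro a ha b hb hab
    have h1 := main a ha
    have h2 := main b hb
    simp only at hab
    rw [h1, h2, hab]

lemma s_split (n Y : ℕ) :
    s n = ∑ p ∈ Qs (Y + 1), ((MM n).filter (fun m => m.minFac = p)).card +
      ((MM n).filter (fun m => Y < m.minFac)).card := by
  rw [s_eq, ← Finset.card_filter_add_card_filter_not (s := MM n) (fun m => ¬ Y < m.minFac)]
  congr 1
  · rw [Finset.card_eq_sum_card_fiberwise (f := Nat.minFac) (t := Qs (Y + 1))]
    · apply Finset.sum_congr rfl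
      intro p hp
      congr 1
      ext m
      simp only [Qs, Finset.mem_filter, Finset.mem_range] at hp ⊢
      constructor
      · rintro ⟨⟨a, b⟩, d⟩; exact ⟨a, d⟩
      · rintro ⟨a, d⟩; exact ⟨⟨a, by omega⟩, d⟩
    · intro m hm
      simp only [Qs, MM, Finset.coe_filter, Finset.mem_filter, Finset.mem_Icc, Finset.mem_range,
        Set.mem_ofPred_eq] at hm ⊢
      exact ⟨by omega, Nat.minFac_prime (by omega)⟩
  · congr 1; ext m; simp

lemma PP_nonneg (k : ℕ) : 0 ≤ PP k := by
  apply Finset.prod_nonneg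
  intro q hq
  have h : (1 : ℝ) ≤ q := by exact_mod_cast (Qs_prime k q hq).one_le
  have : 1 / (q : ℝ) ≤ 1 := by rw [div_le_one (by linarith)]; exact h
  linarith

lemma PP_le_one (k : ℕ) : PP k ≤ 1 := by
  apply Finset.prod_le_one
  · intro q hq
    have h : (1 : ℝ) ≤ q := by exact_mod_cast (Qs_prime k q hq).one_le
    have : 1 / (q : ℝ) ≤ 1 := by rw [div_le_one (by linarith)]; exact h
    linarith
  · intro q hq
    have : 0 ≤ 1 / (q : ℝ) := by positivity
    linarith

lemma log_le_PP_inv (k : ℕ) : Real.log (k + 1 : ℕ) ≤ (PP (k + 1))⁻¹ := by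
  let f : ℕ →* ℝ :=
    { toFun := fun n => (n : ℝ)⁻¹
      map_one' := by simp
      map_mul' := fun a b => by push_cast; rw [mul_inv] }
  have hf : ∀ {p : ℕ}, p.Prime → ‖f p‖ < 1 := by
    intro p hp
    have : (1 : ℝ) < p := by exact_mod_cast hp.one_lt
    change ‖(p : ℝ)⁻¹‖ < 1
    rw [norm_inv, Real.norm_natCast]
    exact inv_lt_one_of_one_lt₀ this
  have h := (EulerProduct.summable_and_hasSum_smoothNumbers_prod_primesBelow_geometric (f := f) hf (k + 1)).2
  have e : (PP (k + 1))⁻¹ = ∏ p ∈ (k + 1).primesBelow, (1 - f p)⁻¹ := by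
    rw [PP, ← Finset.prod_inv_distrib]
    apply Finset.prod_congr rfl
    intro p _
    change _ = (1 - (p : ℝ)⁻¹)⁻¹
    rw [one_div]
  rw [e]
  refine (log_add_one_le_harmonic k).trans ?_
  have hm : ∀ m ∈ Finset.Icc 1 k, m ∈ (k + 1).smoothNumbers := by
    intro m hm
    rw [Finset.mem_Icc] at hm
    exact Nat.mem_smoothNumbers_of_lt (by omega) (by omega)
  rw [harmonic_eq_sum_Icc, ← h.tsum_eq]
  push_cast
  rw [← Finset.sum_attach]
  have hinj : Function.Injective (fun m : {x // x ∈ Finset.Icc 1 k} =>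
      (⟨m.1, hm m.1 m.2⟩ : (k + 1).smoothNumbers)) := by
    intro a b hab
    exact Subtype.ext (congrArg (fun z : (k + 1).smoothNumbers => (z : ℕ)) hab)
  have := h.summable.sum_le_tsum ((Finset.Icc 1 k).attach.map ⟨_, hinj⟩)
    (fun i _ => by change (0 : ℝ) ≤ ((i : ℕ) : ℝ)⁻¹; positivity)
  rw [Finset.sum_map] at this
  exact this

lemma PP_pos (k : ℕ) : 0 < PP k := by
  apply Finset.prod_pos
  intro q hq
  have h : (1 : ℝ) < q := by exact_mod_cast (Qs_prime k q hq).one_lt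
  have : 1 / (q : ℝ) < 1 := by rw [div_lt_one (by linarith)]; exact h
  linarith

lemma PP_le (k : ℕ) (L : ℝ) (hL : 1 < L) (hk : L ≤ k) : PP k ≤ 1 / Real.log L := by
  have hlog : 0 < Real.log L := Real.log_pos hL
  obtain ⟨j, rfl⟩ : ∃ j, k = j + 1 := by
    cases k with
    | zero => simp at hk; linarith
    | succ j => exact ⟨j, rfl⟩
  have h1 := (Real.log_le_log (by linarith) hk).trans (log_le_PP_inv j)
  rw [le_div_iff₀ hlog]
  calc PP (j + 1) * Real.log L ≤ PP (j + 1) * (PP (j + 1))⁻¹ :=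
        mul_le_mul_of_nonneg_left h1 (PP_nonneg _)
    _ = 1 := mul_inv_cancel₀ (PP_pos _).ne'

noncomputable def gg (k : ℕ) : ℝ :=
  if k.Prime then (1 / ((k : ℝ) * (k + 1))) * PP k else 0

lemma gg_nonneg (k : ℕ) : 0 ≤ gg k := by
  unfold gg
  split_ifs
  · exact mul_nonneg (by positivity) (PP_nonneg k)
  · exact le_rfl

lemma gg_partial (Y : ℕ) (B : ℝ) (hB : 0 ≤ B) (h : ∀ k, Y + 1 ≤ k → PP k ≤ B) (N : ℕ) :
    ∑ i ∈ Finset.range N, gg (i + (Y + 1)) ≤ B * (1 / (Y + 1) - 1 / (Y + 1 + N)) := by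
  induction N with
  | zero => simp
  | succ N ih =>
    rw [Finset.sum_range_succ]
    have hb : gg (N + (Y + 1)) ≤ B * (1 / (Y + 1 + N) - 1 / (Y + 1 + (N + 1 : ℕ))) := by
      have e : (1 / (Y + 1 + N) - 1 / (Y + 1 + (N + 1 : ℕ)) : ℝ) =
          1 / (((N + (Y + 1) : ℕ) : ℝ) * ((N + (Y + 1) : ℕ) + 1)) := by
        push_cast
        field_simp
        ring
      rw [e]
      unfold gg
      split_ifs
      · rw [mul_comm]
        exact mul_le_mul_of_nonneg_right (h _ (by omega)) (by positivity)
      · positivity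
    linarith

lemma gg_partial' (Y : ℕ) (B : ℝ) (hB : 0 ≤ B) (h : ∀ k, Y + 1 ≤ k → PP k ≤ B) (N : ℕ) :
    ∑ i ∈ Finset.range N, gg (i + (Y + 1)) ≤ B / (Y + 1) := by
  refine (gg_partial Y B hB h N).trans ?_
  have : (0 : ℝ) ≤ 1 / (Y + 1 + N) := by positivity
  rw [div_eq_mul_one_div B]
  exact mul_le_mul_of_nonneg_left (by linarith) hB

lemma gg_summable : Summable gg := by
  rw [← summable_nat_add_iff 1]
  exact summable_of_sum_range_le (fun _ => gg_nonneg _)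
    (gg_partial' 0 1 zero_le_one (fun k _ => PP_le_one k))

lemma c_eq : c = ∑' k, gg k := by
  have : c = ∑' p : {p : ℕ // p.Prime}, (fun k : ℕ => (1 / ((k : ℝ) * (k + 1))) * PP k) p := rfl
  rw [this]
  have h2 := tsum_subtype {p : ℕ | p.Prime} (fun k : ℕ => (1 / ((k : ℝ) * (k + 1))) * PP k)
  refine Eq.trans h2 ?_
  apply tsum_congr
  intro k
  simp [Set.indicator, gg]

lemma c_split (Y : ℕ) : c = ∑ p ∈ Qs (Y + 1), (1 / ((p : ℝ) * (p + 1))) * PP p +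
    ∑' i, gg (i + (Y + 1)) := by
  rw [c_eq, ← gg_summable.sum_add_tsum_nat_add (Y + 1), Qs, Finset.sum_filter]
  rfl

lemma fiber_bound (n p Y : ℕ) (hp : p.Prime) (hY : p ≤ Y) :
    |(((MM n).filter (fun m => m.minFac = p)).card : ℝ) - (1 / ((p : ℝ) * (p + 1))) * PP p * n|
      ≤ 2 * 2 ^ Y := by
  have e := fiber_card n p hp
  have e' : (((MM n).filter (fun m => m.minFac = p)).card : ℝ) =
      AA (Qs p) (n / p) - AA (Qs p) (n / (p + 1)) := by rw [← e]; push_cast; ring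
  have a := AA_bound' p n p
  have b := AA_bound' p n (p + 1)
  have hp0 : (p : ℝ) ≠ 0 := by exact_mod_cast hp.ne_zero
  have hpow : (2 : ℝ) ^ p ≤ 2 ^ Y := pow_le_pow_right₀ (by norm_num) hY
  have e2 : (1 / ((p : ℝ) * (p + 1))) * PP p * n = n / p * PP p - n / (p + 1 : ℕ) * PP p := by
    push_cast
    field_simp
    ring
  rw [e', e2]
  rw [abs_le] at *
  constructor <;> linarith

lemma main_bound (n Y : ℕ) (L : ℝ) (hL : 1 < L) (hY : (Y : ℝ) ≤ L) (hY' : L ≤ (Y + 1 : ℕ)) :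
    |(s n : ℝ) - c * n| ≤ n / (L * Real.log L) + (2 * L + 4) * 2 ^ Y := by
  have hlog : 0 < Real.log L := Real.log_pos hL
  have hB : ∀ k, Y + 1 ≤ k → PP k ≤ 1 / Real.log L := fun k hk =>
    PP_le k L hL (hY'.trans (by exact_mod_cast hk))
  set T := ∑' i, gg (i + (Y + 1)) with hT
  have hLY : L ≤ (Y : ℝ) + 1 := by exact_mod_cast hY'
  have hT0 : 0 ≤ T := tsum_nonneg (fun _ => gg_nonneg _)
  have hinv : (1 / Real.log L) / ((Y : ℝ) + 1) ≤ 1 / (L * Real.log L) := by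
    rw [div_div, mul_comm L]
    apply one_div_le_one_div_of_le (by positivity)
    exact mul_le_mul_of_nonneg_left hLY hlog.le
  have hT1 : T ≤ 1 / (L * Real.log L) :=
    (Real.tsum_le_of_sum_range_le (fun _ => gg_nonneg _)
      (gg_partial' Y _ (by positivity) hB)).trans hinv
  set R := ((MM n).filter (fun m => Y < m.minFac)).card with hR
  have hR1 : (R : ℝ) ≤ n * (1 / (L * Real.log L)) + 2 * 2 ^ Y := by
    have h1 : (R : ℝ) ≤ AA (Qs (Y + 1)) (n / (Y + 1)) := by exact_mod_cast tail_card n Y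
    have h2 := (abs_le.1 (AA_bound' (Y + 1) n (Y + 1))).2
    have h3 : (n : ℝ) / (Y + 1 : ℕ) * PP (Y + 1) ≤ n * (1 / (L * Real.log L)) := by
      calc (n : ℝ) / (Y + 1 : ℕ) * PP (Y + 1) ≤ (n : ℝ) / (Y + 1 : ℕ) * (1 / Real.log L) :=
            mul_le_mul_of_nonneg_left (hB _ le_rfl) (by positivity)
        _ = n * ((1 / Real.log L) / ((Y : ℝ) + 1)) := by push_cast; ring
        _ ≤ _ := mul_le_mul_of_nonneg_left hinv (by positivity)
    rw [pow_succ] at h2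
    linarith
  have hsum : |(∑ p ∈ Qs (Y + 1), (((MM n).filter (fun m => m.minFac = p)).card : ℝ)) -
      (∑ p ∈ Qs (Y + 1), (1 / ((p : ℝ) * (p + 1))) * PP p) * n| ≤ (L + 1) * (2 * 2 ^ Y) := by
    rw [Finset.sum_mul, ← Finset.sum_sub_distrib]
    refine (Finset.abs_sum_le_sum_abs _ _).trans ?_
    refine (Finset.sum_le_card_nsmul _ _ (2 * 2 ^ Y) ?_).trans ?_
    · intro p hp
      simp only [Qs, Finset.mem_filter, Finset.mem_range] at hp
      exact fiber_bound n p Y hp.2 (by omega)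
    · rw [nsmul_eq_mul]
      apply mul_le_mul_of_nonneg_right _ (by positivity)
      have : ((Qs (Y + 1)).card : ℝ) ≤ (Y + 1 : ℕ) := by exact_mod_cast Qs_card (Y + 1)
      push_cast at this
      linarith
  have hs : (s n : ℝ) = (∑ p ∈ Qs (Y + 1), (((MM n).filter (fun m => m.minFac = p)).card : ℝ)) + R := by
    rw [s_split n Y]; push_cast; rfl
  have hTn : T * n ≤ 1 / (L * Real.log L) * n := mul_le_mul_of_nonneg_right hT1 (by positivity)
  have hTn0 : 0 ≤ T * n := by positivity
  have hR0 : (0 : ℝ) ≤ R := by positivity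
  have hpow : (0 : ℝ) < 2 ^ Y := by positivity
  rw [hs, c_split Y, ← hT]
  rw [abs_le] at *
  have hdiv : (n : ℝ) / (L * Real.log L) = n * (1 / (L * Real.log L)) := by ring
  rw [hdiv]
  constructor <;> nlinarith

lemma ev_bound : ∀ᶠ L : ℝ in Filter.atTop, (2 * L + 4) * (L * L) ≤ Real.exp ((1 - Real.log 2) * L) := by
  have hb : 0 < 1 - Real.log 2 := by linarith [Real.log_two_lt_d9]
  have h := (isLittleO_pow_exp_pos_mul_atTop 3 hb).bound (show (0 : ℝ) < 1 / 6 by norm_num)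
  filter_upwards [h, Filter.eventually_ge_atTop 1] with L h1 h2
  rw [Real.norm_of_nonneg (by positivity), Real.norm_of_nonneg (by positivity)] at h1
  nlinarith [mul_nonneg (sub_nonneg.2 h2) (mul_self_nonneg L)]

lemma ev_main : ∀ᶠ n : ℕ in Filter.atTop,
    |(s n : ℝ) - c * n| ≤ 2 * n / (Real.log n * Real.log (Real.log n)) := by
  have ht : Filter.Tendsto (fun n : ℕ => Real.log n) Filter.atTop Filter.atTop :=
    Real.tendsto_log_atTop.comp tendsto_natCast_atTop_atTop
  filter_upwards [ht.eventually ev_bound, ht.eventually (Filter.eventually_gt_atTop 1),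
    Filter.eventually_gt_atTop 0] with n h1 h2 h3
  set L := Real.log n with hL
  have hn : (n : ℝ) = Real.exp L := by rw [hL, Real.exp_log (by exact_mod_cast h3)]
  have hfl := Nat.floor_le (show 0 ≤ L by linarith)
  have hfl2 := (Nat.lt_floor_add_one L).le
  have hm := main_bound n ⌊L⌋₊ L h2 hfl (by push_cast; exact hfl2)
  have hlog : 0 < Real.log L := Real.log_pos h2
  have hlogle : Real.log L ≤ L := by linarith [Real.log_le_sub_one_of_pos (show 0 < L by linarith)]
  have hpw : (2 : ℝ) ^ ⌊L⌋₊ ≤ Real.exp (Real.log 2 * L) := by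
    rw [← Real.rpow_natCast, Real.rpow_def_of_pos (by norm_num)]
    apply Real.exp_le_exp.2
    exact mul_le_mul_of_nonneg_left hfl (Real.log_nonneg (by norm_num))
  have hE : (2 * L + 4) * 2 ^ ⌊L⌋₊ ≤ n / (L * Real.log L) := by
    rw [le_div_iff₀ (by positivity)]
    calc (2 * L + 4) * 2 ^ ⌊L⌋₊ * (L * Real.log L)
        ≤ (2 * L + 4) * Real.exp (Real.log 2 * L) * (L * L) := by gcongr
      _ = ((2 * L + 4) * (L * L)) * Real.exp (Real.log 2 * L) := by ring
      _ ≤ Real.exp ((1 - Real.log 2) * L) * Real.exp (Real.log 2 * L) := by gcongr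
      _ = n := by rw [← Real.exp_add, hn]; congr 1; ring
  have : 2 * (n : ℝ) / (L * Real.log L) = n / (L * Real.log L) + n / (L * Real.log L) := by ring
  linarith

theorem s_asymptotics :
    (∃ C > (0 : ℝ), ∃ N : ℕ, ∀ n : ℕ, N ≤ n →
      |(s n : ℝ) - c * n| ≤ C * n / (Real.log n * Real.log (Real.log n))) ∧
    Filter.Tendsto (fun n : ℕ => (s n : ℝ) / n) Filter.atTop (nhds c) := by
  constructor
  · obtain ⟨N, hN⟩ := Filter.eventually_atTop.1 ev_main
    exact ⟨2, by norm_num, N, hN⟩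
  · rw [tendsto_iff_norm_sub_tendsto_zero]
    have ht : Filter.Tendsto (fun n : ℕ => Real.log n) Filter.atTop Filter.atTop :=
      Real.tendsto_log_atTop.comp tendsto_natCast_atTop_atTop
    have ht2 := ht.atTop_mul_atTop₀ (Real.tendsto_log_atTop.comp ht)
    have ht3 := ht2.const_div_atTop 2
    refine squeeze_zero' (Filter.Eventually.of_forall fun _ => norm_nonneg _) ?_ ht3
    filter_upwards [ev_main, Filter.eventually_gt_atTop 0] with n h1 h2
    have hn : (0 : ℝ) < n := by exact_mod_cast h2
    have e : (s n : ℝ) / n - c = ((s n : ℝ) - c * n) / n := by field_simp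
    rw [e, Real.norm_eq_abs, abs_div, abs_of_pos hn, div_le_iff₀ hn]
    refine h1.trans (le_of_eq ?_)
    simp only [Function.comp]
    ring
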